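/- Let X be a compact metric space, f : X → X a continuous map with the s-limit shadowing property, C a chain component of f and D ∈ 𝒟(C). Let ℱ, 𝒢 be full Furstenberg families that are compatible with (X^n, f^{×n}) for all n ≥ 2, and assume ℱ is translation invariant. For any n ≥ 2 and δ > 0, if there is an n-tuple (a_1,…,a_n) ∈ [V^s(D)]^n with S_f(a_1,…,a_n;δ) ∈ ℱ, then for every E ∈ 𝒟(C) and every 0 < r < δ, V^s(E) is generic (ℱ,𝒢)-n-r-chaotic for f. -/

import Mathlib

open Filter Metric Set Topology

section Defs

variable {X : Type*} [MetricSpace X]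

/-- A δ-chain of `f` of length `k` (with `k ≥ 1`) within the set `C`, from `x` to `y`. -/
def ChainIn (f : X → X) (C : Set X) (δ : ℝ) (k : ℕ) (x y : X) : Prop :=
  1 ≤ k ∧ ∃ c : ℕ → X, c 0 = x ∧ c k = y ∧ (∀ i ≤ k, c i ∈ C) ∧
    ∀ i < k, dist (f (c i)) (c (i + 1)) ≤ δ

/-- `x → y` : for every `δ > 0` there is a `δ`-chain of `f` from `x` to `y`. -/
def ChainReach (f : X → X) (x y : X) : Prop :=
  ∀ δ > 0, ∃ k, ChainIn f Set.univ δ k x y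

/-- `x` is chain recurrent for `f`. -/
def ChainRecurrent (f : X → X) (x : X) : Prop := ChainReach f x x

/-- `C` is a chain component of `f`: an equivalence class of the relation `↔`
on the set of chain recurrent points. -/
def IsChainComponent (f : X → X) (C : Set X) : Prop :=
  ∃ x, ChainRecurrent f x ∧
    C = {y | ChainRecurrent f y ∧ ChainReach f x y ∧ ChainReach f y x}

/-- The set of lengths of δ-cycles of `f` restricted to `C`. -/
def cycleLengths (f : X → X) (C : Set X) (δ : ℝ) : Set ℕ :=
  {k | ∃ x ∈ C, ChainIn f C δ k x x}

/-- The greatest common divisor of a set of natural numbers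
(the greatest natural number dividing every element). -/
noncomputable def setGcd (S : Set ℕ) : ℕ := sSup {d | ∀ k ∈ S, d ∣ k}

/-- `x ∼_{C,δ} y` : there is a δ-chain of `f|_C` from `x` to `y` whose length is
divisible by `m(C,δ)`, the gcd of the lengths of all δ-cycles of `f|_C`. -/
def SimCd (f : X → X) (C : Set X) (δ : ℝ) (x y : X) : Prop :=
  ∃ k, setGcd (cycleLengths f C δ) ∣ k ∧ ChainIn f C δ k x y

/-- `x ∼_C y` : `x ∼_{C,δ} y` for all `δ > 0`. -/
def SimC (f : X → X) (C : Set X) (x y : X) : Prop :=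
  ∀ δ > 0, SimCd f C δ x y

/-- `𝒟(C,δ)` : the set of equivalence classes of `∼_{C,δ}`. -/
def DClassesd (f : X → X) (C : Set X) (δ : ℝ) : Set (Set X) :=
  {D | ∃ x ∈ C, D = {y ∈ C | SimCd f C δ x y}}

/-- `𝒟(C)` : the set of equivalence classes of `∼_C`. -/
def DClasses (f : X → X) (C : Set X) : Set (Set X) :=
  {D | ∃ x ∈ C, D = {y ∈ C | SimC f C x y}}

/-- `W^s(C) = {x : lim_{i→∞} d(f^i(x), C) = 0}`. -/
def wStable (f : X → X) (C : Set X) : Set X :=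
  {x | Tendsto (fun i => infDist (f^[i] x) C) atTop (nhds 0)}

/-- `V^s(D) = ⋂_{δ>0} {x ∈ W^s(C) : lim_{i→∞} d(f^i(x), f^i(D_δ)) = 0}`, where
`D_δ` is the unique element of `𝒟(C,δ)` containing `D`. -/
def vStable (f : X → X) (C D : Set X) : Set X :=
  {x | x ∈ wStable f C ∧ ∀ δ > 0, ∀ Dd ∈ DClassesd f C δ, D ⊆ Dd →
    Tendsto (fun i => infDist (f^[i] x) (f^[i] '' Dd)) atTop (nhds 0)}

/-- The s-limit shadowing property. -/
def SLimitShadowing (f : X → X) : Prop :=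
  ∀ ε > 0, ∃ δ > 0, ∀ x : ℕ → X,
    (∀ i, dist (f (x i)) (x (i + 1)) ≤ δ) →
    Tendsto (fun i => dist (f (x i)) (x (i + 1))) atTop (nhds 0) →
    ∃ z : X, (∀ i, dist (f^[i] z) (x i) ≤ ε) ∧
      Tendsto (fun i => dist (f^[i] z) (x i)) atTop (nhds 0)

/-- The limit shadowing property. -/
def LimitShadowing (f : X → X) : Prop :=
  ∀ x : ℕ → X, Tendsto (fun i => dist (f (x i)) (x (i + 1))) atTop (nhds 0) →
    ∃ z : X, Tendsto (fun i => dist (f^[i] z) (x i)) atTop (nhds 0)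

/-- The (plain) shadowing property. -/
def ShadowingProperty (f : X → X) : Prop :=
  ∀ ε > 0, ∃ δ > 0, ∀ x : ℕ → X, (∀ i, dist (f (x i)) (x (i + 1)) ≤ δ) →
    ∃ z : X, ∀ i, dist (f^[i] z) (x i) ≤ ε

/-- A Furstenberg family: hereditary upward and proper. -/
def FurstenbergFamily (F : Set (Set ℕ)) : Prop :=
  (∀ A B : Set ℕ, A ∈ F → A ⊆ B → B ∈ F) ∧ F.Nonempty ∧ F ≠ Set.univ

/-- A full Furstenberg family. -/
def FullFamily (F : Set (Set ℕ)) : Prop :=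
  ∀ A ∈ F, ∀ n : ℕ, {i ∈ A | n ≤ i} ∈ F

/-- A translation invariant Furstenberg family. -/
def TranslationInvariantFamily (F : Set (Set ℕ)) : Prop :=
  ∀ A ∈ F, ∀ n : ℕ, ((fun i => i + n) '' A ∈ F ∧ {i | i + n ∈ A} ∈ F)

/-- `S_f(x₁,…,xₙ; r) = {i : min_{j<k} d(fⁱ(x_j), fⁱ(x_k)) > r}`. -/
def Sset (f : X → X) {n : ℕ} (x : Fin n → X) (r : ℝ) : Set ℕ :=
  {i | ∀ j k : Fin n, j < k → r < dist (f^[i] (x j)) (f^[i] (x k))}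

/-- `T_f(x₁,…,xₙ; r) = {i : max_{j<k} d(fⁱ(x_j), fⁱ(x_k)) < r}`. -/
def Tset (f : X → X) {n : ℕ} (x : Fin n → X) (r : ℝ) : Set ℕ :=
  {i | ∀ j k : Fin n, j < k → dist (f^[i] (x j)) (f^[i] (x k)) < r}

/-- `(x₁,…,xₙ)` is an `(ℱ,𝒢)`-δ-scrambled n-tuple for `f`. -/
def Scrambled (f : X → X) (F G : Set (Set ℕ)) (δ : ℝ) {n : ℕ} (x : Fin n → X) : Prop :=
  Sset f x δ ∈ F ∧ ∀ ε > 0, Tset f x ε ∈ G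

/-- `Y` is dense `(ℱ,𝒢)`-n-δ-chaotic for `f`: the `(ℱ,𝒢)`-δ-scrambled n-tuples in `Yⁿ`
form a dense subset of `Yⁿ`. -/
def DenseChaotic (f : X → X) (F G : Set (Set ℕ)) (n : ℕ) (δ : ℝ) (Y : Set X) : Prop :=
  {x : Fin n → X | ∀ j, x j ∈ Y} ⊆
    closure {x : Fin n → X | (∀ j, x j ∈ Y) ∧ Scrambled f F G δ x}

/-- `S` is a residual subset of the subspace `T`: it contains a countable intersection of
dense open subsets of `T`. -/
def ResidualIn {α : Type*} [TopologicalSpace α] (T S : Set α) : Prop :=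
  ∃ U : ℕ → Set α, (∀ i, IsOpen (U i)) ∧ (∀ i, T ⊆ closure (U i ∩ T)) ∧
    (⋂ i, U i) ∩ T ⊆ S

/-- `Y` is generic `(ℱ,𝒢)`-n-δ-chaotic for `f`: the `(ℱ,𝒢)`-δ-scrambled n-tuples in `Yⁿ`
form a residual subset of `Yⁿ`. -/
def GenericChaotic (f : X → X) (F G : Set (Set ℕ)) (n : ℕ) (δ : ℝ) (Y : Set X) : Prop :=
  ResidualIn {x : Fin n → X | ∀ j, x j ∈ Y}
    {x : Fin n → X | (∀ j, x j ∈ Y) ∧ Scrambled f F G δ x}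

/-- A Furstenberg family `F` is compatible with `(Z, g)`. -/
def CompatibleFamily {Z : Type*} [TopologicalSpace Z] (F : Set (Set ℕ)) (g : Z → Z) : Prop :=
  ∀ U : Set Z, IsOpen U → IsGδ {z | {i | g^[i] z ∈ U} ∈ F}

end Defs

section Chains

variable {X : Type*} [MetricSpace X] {f : X → X} {C : Set X} {δ η : ℝ} {k l : ℕ} {x y z : X}

theorem ChainIn.mono (h : ChainIn f C η k x y) (hηδ : η ≤ δ) : ChainIn f C δ k x y := by
  obtain ⟨hk, c, h0, h1, hc, hd⟩ := h
  exact ⟨hk, c, h0, h1, hc, fun i hi => (hd i hi).trans hηδ⟩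

theorem ChainIn.left_mem (h : ChainIn f C δ k x y) : x ∈ C := by
  obtain ⟨hk, c, h0, h1, hc, hd⟩ := h
  exact h0 ▸ hc 0 (Nat.zero_le _)

theorem ChainIn.right_mem (h : ChainIn f C δ k x y) : y ∈ C := by
  obtain ⟨hk, c, h0, h1, hc, hd⟩ := h
  exact h1 ▸ hc k le_rfl

theorem ChainIn.trans (h : ChainIn f C δ k x y) (h' : ChainIn f C δ l y z) :
    ChainIn f C δ (k + l) x z := by
  obtain ⟨hk, c, h0, h1, hc, hd⟩ := h
  obtain ⟨hl, c', h0', h1', hc', hd'⟩ := h'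
  refine ⟨by omega, fun i => if i ≤ k then c i else c' (i - k), by simp [h0], ?_, ?_, ?_⟩
  · dsimp only
    rw [if_neg (by omega)]
    simpa using h1'
  · intro i hi
    dsimp only
    split_ifs with h
    · exact hc i h
    · exact hc' _ (by omega)
  · intro i hi
    dsimp only
    rcases lt_trichotomy i k with h | h | h
    · rw [if_pos h.le, if_pos (by omega)]
      exact hd i h
    · subst h
      rw [if_pos le_rfl, if_neg (by omega), h1, ← h0']
      simpa using hd' 0 (by omega)
    · rw [if_neg (by omega), if_neg (by omega), show i + 1 - k = i - k + 1 by omega]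
      exact hd' _ (by omega)

/-- An orbit segment staying in `C` is a chain. -/
theorem chainIn_iterate (hfC : MapsTo f C C) (hδ : 0 ≤ δ) (hx : x ∈ C) (hk : 1 ≤ k) :
    ChainIn f C δ k x (f^[k] x) :=
  ⟨hk, fun i => f^[i] x, rfl, rfl, fun i _ => hfC.iterate i hx, fun i _ => by
    dsimp only
    rw [Function.iterate_succ_apply', dist_self]; exact hδ⟩

theorem ChainIn.split_at {c : ℕ → X} (h0 : c 0 = x) (h1 : c k = y) (hc : ∀ i ≤ k, c i ∈ C)
    (hd : ∀ i < k, dist (f (c i)) (c (i + 1)) ≤ δ) {i : ℕ} (hi : i ≤ k) :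
    (1 ≤ i → ChainIn f C δ i x (c i)) ∧ (i < k → ChainIn f C δ (k - i) (c i) y) := by
  refine ⟨fun h => ⟨h, c, h0, rfl, fun j hj => hc j (by omega), fun j hj => hd j (by omega)⟩,
    fun h => ⟨by omega, fun j => c (i + j), rfl, ?_, fun j hj => hc _ (by omega),
      fun j hj => hd _ (by omega)⟩⟩
  dsimp only
  rwa [Nat.add_sub_cancel' hi]

/-- Chains in `X` persist under small perturbation of all of their points. -/
theorem exists_chain_perturb [CompactSpace X] (hf : Continuous f) (hδ : 0 < δ) :
    ∃ γ > 0, γ ≤ δ ∧ ∀ (k : ℕ) (c c' : ℕ → X), (∀ i < k, dist (f (c i)) (c (i + 1)) ≤ γ) →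
      (∀ i ≤ k, dist (c i) (c' i) ≤ γ) → ∀ i < k, dist (f (c' i)) (c' (i + 1)) ≤ δ := by
  obtain ⟨ω, hω, h⟩ := Metric.uniformContinuous_iff.1
    (CompactSpace.uniformContinuous_of_continuous hf) (δ / 3) (by positivity)
  refine ⟨min (ω / 2) (δ / 3), by positivity, (min_le_right _ _).trans (by linarith), ?_⟩
  intro k c c' hc hcc' i hi
  have h1 := hc i hi
  have h2 := hcc' i hi.le
  have h3 := hcc' (i + 1) hi
  have h4 : dist (c' i) (c i) < ω := by
    rw [dist_comm]
    linarith [min_le_left (ω / 2) (δ / 3)]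
  have h5 := h h4
  have h6 := dist_triangle4 (f (c' i)) (f (c i)) (c (i + 1)) (c' (i + 1))
  linarith [min_le_right (ω / 2) (δ / 3)]

theorem exists_chainIn_perturb_endpoints [CompactSpace X] (hf : Continuous f) (hδ : 0 < δ) :
    ∃ γ > 0, γ ≤ δ ∧ ∀ (k : ℕ) (x x' y y' : X), ChainIn f univ γ k x y → dist x x' ≤ γ →
      dist y y' ≤ γ → ChainIn f univ δ k x' y' := by
  obtain ⟨γ, hγ, hγδ, h⟩ := exists_chain_perturb hf hδ
  refine ⟨γ, hγ, hγδ, fun k x x' y y' ⟨hk, c, h0, h1, _, hd⟩ hx hy =>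
    ⟨hk, fun i => if i = 0 then x' else if i = k then y' else c i, by simp, ?_,
      fun _ _ => mem_univ _, h k c _ hd ?_⟩⟩
  · dsimp only
    rw [if_neg (by omega), if_pos rfl]
  · intro i hi
    split_ifs with h2 h3
    · rwa [h2, h0]
    · rwa [h3, h1]
    · rw [dist_self]
      exact hγ.le

theorem ChainReach.trans (h : ChainReach f x y) (h' : ChainReach f y z) : ChainReach f x z :=
  fun δ hδ => by
    obtain ⟨k, hk⟩ := h δ hδ
    obtain ⟨l, hl⟩ := h' δ hδ
    exact ⟨_, hk.trans hl⟩

theorem IsChainComponent.mem_iff (hC : IsChainComponent f C) (hx : x ∈ C) :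
    y ∈ C ↔ ChainReach f x y ∧ ChainReach f y x := by
  obtain ⟨w, -, rfl⟩ := hC
  obtain ⟨-, h1, h2⟩ := hx
  exact ⟨fun ⟨_, h3, h4⟩ => ⟨h2.trans h3, h4.trans h1⟩,
    fun ⟨h3, h4⟩ => ⟨h4.trans h3, h1.trans h3, h4.trans h2⟩⟩

theorem IsChainComponent.exists_long_cycle (hC : IsChainComponent f C) (hx : x ∈ C)
    (hδ : 0 < δ) : ∃ k, 2 ≤ k ∧ ChainIn f univ δ k x x := by
  obtain ⟨k, hk⟩ := ((hC.mem_iff hx).1 hx).1 δ hδ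
  exact ⟨k + k, by have := hk.1; omega, hk.trans hk⟩

variable [CompactSpace X]

theorem IsChainComponent.mem_of_approx (hf : Continuous f) (hC : IsChainComponent f C)
    (hx : x ∈ C) (h : ∀ γ > 0, ∃ z', dist z' z ≤ γ ∧ (∃ k, ChainIn f univ γ k x z') ∧
      ∃ k, ChainIn f univ γ k z' x) : z ∈ C := by
  rw [hC.mem_iff hx]
  constructor <;> intro δ hδ <;>
    obtain ⟨γ, hγ, -, hp⟩ := exists_chainIn_perturb_endpoints hf hδ <;>
    obtain ⟨z', hz, ⟨k, hk⟩, l, hl⟩ := h γ hγ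
  · exact ⟨k, hp _ _ _ _ _ hk (by simpa using hγ.le) hz⟩
  · exact ⟨l, hp _ _ _ _ _ hl hz (by simpa using hγ.le)⟩

theorem IsChainComponent.isClosed (hf : Continuous f) (hC : IsChainComponent f C) :
    IsClosed C := by
  refine isClosed_of_closure_subset fun z hz => ?_
  obtain ⟨x, hx⟩ := closure_nonempty_iff.1 ⟨z, hz⟩
  refine hC.mem_of_approx hf hx fun γ hγ => ?_
  obtain ⟨w, hw, hd⟩ := Metric.mem_closure_iff.1 hz γ hγ
  have := (hC.mem_iff hx).1 hw
  exact ⟨w, by rw [dist_comm]; exact hd.le, this.1 γ hγ, this.2 γ hγ⟩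

/-- Every point of a cycle with small jumps through a point of `C` is close to `C`. -/
theorem IsChainComponent.exists_near (hf : Continuous f) (hC : IsChainComponent f C)
    (hx : x ∈ C) {γ : ℝ} (hγ : 0 < γ) : ∃ δ > 0, δ ≤ γ ∧ ∀ z,
      (∃ k, ChainIn f univ δ k x z) → (∃ k, ChainIn f univ δ k z x) → ∃ w ∈ C, dist z w ≤ γ := by
  by_contra! hcon
  have hpos : ∀ n : ℕ, 0 < γ / (n + 1) := fun n => by positivity
  choose z hxz hzx hz using fun n : ℕ => hcon (γ / (n + 1)) (hpos n)
    (div_le_self hγ.le (by linarith [n.cast_nonneg (α := ℝ)]))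
  obtain ⟨w, φ, hφ, hw⟩ := CompactSpace.tendsto_subseq z
  have hlim : Tendsto (fun n : ℕ => γ / ((n : ℝ) + 1)) atTop (𝓝 0) :=
    tendsto_const_nhds.div_atTop (tendsto_natCast_atTop_atTop.atTop_add tendsto_const_nhds)
  have hwC : w ∈ C := by
    refine hC.mem_of_approx hf hx fun ε hε => ?_
    have h1 : ∀ᶠ n in atTop, dist (z (φ n)) w < ε := Metric.tendsto_nhds.1 hw ε hε
    have h2 : ∀ᶠ n in atTop, γ / ((φ n : ℕ) + 1 : ℝ) < ε :=
      (hlim.comp hφ.tendsto_atTop).eventually (gt_mem_nhds hε)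
    obtain ⟨n, hn1, hn2⟩ := (h1.and h2).exists
    obtain ⟨k, hk⟩ := hxz (φ n)
    obtain ⟨l, hl⟩ := hzx (φ n)
    exact ⟨z (φ n), hn1.le, ⟨k, hk.mono hn2.le⟩, l, hl.mono hn2.le⟩
  obtain ⟨n, hn⟩ := (Metric.tendsto_nhds.1 hw γ hγ).exists
  exact lt_asymm hn (hz _ w hwC)

/-- A chain component is internally chain transitive. -/
theorem IsChainComponent.exists_chainIn (hf : Continuous f) (hC : IsChainComponent f C)
    (hx : x ∈ C) (hy : y ∈ C) (hδ : 0 < δ) : ∃ k, ChainIn f C δ k x y := by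
  classical
  obtain ⟨γ, hγ, -, hp⟩ := exists_chain_perturb hf hδ
  obtain ⟨η, hη, hηγ, hn⟩ := hC.exists_near hf hx hγ
  obtain ⟨hxy, hyx⟩ := (hC.mem_iff hx).1 hy
  obtain ⟨k, hk, c, h0, h1, hc, hd⟩ := hxy η hη
  obtain ⟨l, hl⟩ := hyx η hη
  have key : ∀ i, ∃ w ∈ C, i ≤ k → dist (c i) w ≤ γ ∧ (i = 0 → w = x) ∧ (i = k → w = y) := by
    intro i
    by_cases hi0 : i = 0
    · exact ⟨x, hx, fun _ => ⟨by rw [hi0, h0, dist_self]; exact hγ.le, fun _ => rfl, by omega⟩⟩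
    by_cases hik : i = k
    · exact ⟨y, hy, fun _ => ⟨by rw [hik, h1, dist_self]; exact hγ.le, by omega, fun _ => rfl⟩⟩
    by_cases hi : i ≤ k
    · have hs := ChainIn.split_at h0 h1 hc hd hi
      obtain ⟨w, hw, hd⟩ := hn (c i) ⟨_, hs.1 (by omega)⟩ ⟨_, (hs.2 (by omega)).trans hl⟩
      exact ⟨w, hw, fun _ => ⟨hd, by omega, by omega⟩⟩
    · exact ⟨x, hx, fun h => absurd h hi⟩
  choose c' hc'C hc' using key
  exact ⟨k, hk, c', (hc' 0 (by omega)).2.1 rfl, (hc' k le_rfl).2.2 rfl, fun i _ => hc'C i,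
    hp k c c' (fun i hi => (hd i hi).trans hηγ) fun i hi => (hc' i hi).1⟩

theorem IsChainComponent.mapsTo (hf : Continuous f) (hC : IsChainComponent f C) :
    MapsTo f C C := by
  intro x hx
  refine hC.mem_of_approx hf hx fun γ hγ => ?_
  obtain ⟨k, hk2, hk, c, h0, h1, hc, hd⟩ := hC.exists_long_cycle hx hγ
  have hs := ChainIn.split_at h0 h1 hc hd hk
  refine ⟨c 1, ?_, ⟨_, hs.1 le_rfl⟩, _, hs.2 (by omega)⟩
  rw [dist_comm, ← h0]
  exact hd 0 (by omega)

theorem IsChainComponent.surjOn (hf : Continuous f) (hC : IsChainComponent f C) :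
    SurjOn f C C := by
  intro y hy
  have hcl : IsClosed (f '' C) := ((hC.isClosed hf).isCompact.image hf).isClosed
  rw [← hcl.closure_eq, Metric.mem_closure_iff]
  intro ε hε
  obtain ⟨ω, hω, h⟩ := Metric.uniformContinuous_iff.1
    (CompactSpace.uniformContinuous_of_continuous hf) (ε / 2) (by positivity)
  obtain ⟨δ, hδ, hδω, hn⟩ := hC.exists_near hf hy (γ := min (ω / 2) (ε / 4)) (by positivity)
  obtain ⟨k, hk2, hk, c, h0, h1, hc, hd⟩ := hC.exists_long_cycle hy hδ
  have hs := ChainIn.split_at h0 h1 hc hd (Nat.sub_le k 1)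
  obtain ⟨w, hw, hcw⟩ := hn _ ⟨_, hs.1 (by omega)⟩ ⟨_, hs.2 (by omega)⟩
  refine ⟨f w, mem_image_of_mem f hw, ?_⟩
  have h2 : dist (f (c (k - 1))) (f w) < ε / 2 :=
    h (by linarith [min_le_left (ω / 2) (ε / 4)])
  have h3 := hd (k - 1) (by omega)
  rw [show k - 1 + 1 = k by omega, h1] at h3
  have h4 := dist_triangle_left y (f w) (f (c (k - 1)))
  linarith [min_le_right (ω / 2) (ε / 4)]

end Chains

section Phases

theorem setGcd_eq_natSetGcd {S : Set ℕ} {k : ℕ} (hk : k ∈ S) (hk0 : k ≠ 0) :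
    setGcd S = Nat.setGcd S := by
  have h : ∀ d ∈ {d | ∀ k ∈ S, d ∣ k}, d ≤ Nat.setGcd S := fun d hd =>
    Nat.le_of_dvd (Nat.pos_of_ne_zero fun h0 => hk0 (Nat.setGcd_eq_zero_iff.1 h0 hk))
      (Nat.dvd_setGcd_iff.2 hd)
  exact le_antisymm (csSup_le ⟨1, fun k _ => one_dvd k⟩ h)
    (le_csSup ⟨_, h⟩ fun k hk => Nat.setGcd_dvd_of_mem hk)

variable {X : Type*} [MetricSpace X] {f : X → X} {C D E : Set X} {δ η : ℝ} {i j k l : ℕ}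
  {d e x y z q q' : X}

/-- The point `q` can be reached from the base point `e` by an `η`-chain of `f|_C` whose length
is congruent to `i` modulo the `η`-period of `C`. -/
def InPhase (f : X → X) (C : Set X) (e : X) (η : ℝ) (i : ℕ) (q : X) : Prop :=
  ∃ k, k ≡ i [MOD setGcd (cycleLengths f C η)] ∧ ChainIn f C η k e q

theorem InPhase.mem (h : InPhase f C e η i q) : q ∈ C := by
  obtain ⟨k, -, hk⟩ := h
  exact hk.right_mem

theorem InPhase.congr (h : InPhase f C e η i q) (hij : i ≡ j [MOD setGcd (cycleLengths f C η)]) :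
    InPhase f C e η j q := by
  obtain ⟨k, hki, hk⟩ := h
  exact ⟨k, hki.trans hij, hk⟩

theorem InPhase.append (h : InPhase f C e η i q) (hc : ChainIn f C η k q q') :
    InPhase f C e η (i + k) q' := by
  obtain ⟨l, hli, hl⟩ := h
  exact ⟨l + k, hli.add_right k, hl.trans hc⟩

theorem InPhase.change_base (h : InPhase f C d η i q) (hc : ChainIn f C η k e d) :
    InPhase f C e η (k + i) q := by
  obtain ⟨l, hli, hl⟩ := h
  exact ⟨k + l, hli.add_left k, hc.trans hl⟩

theorem InPhase.trans (h : InPhase f C x η 0 e) (h' : InPhase f C e η i q) :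
    InPhase f C x η i q := by
  obtain ⟨k, hk, hc⟩ := h
  exact (h'.change_base hc).congr (by simpa using hk.add_right i)

theorem simCd_iff_inPhase : SimCd f C δ x y ↔ InPhase f C x δ 0 y := by
  simp only [SimCd, InPhase, Nat.modEq_zero_iff_dvd]

variable [CompactSpace X]

theorem IsChainComponent.setGcd_cycleLengths (hf : Continuous f) (hC : IsChainComponent f C)
    (hx : x ∈ C) (hη : 0 < η) :
    setGcd (cycleLengths f C η) = Nat.setGcd (cycleLengths f C η) := by
  obtain ⟨k, hk⟩ := hC.exists_chainIn hf hx hx hη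
  exact setGcd_eq_natSetGcd ⟨x, hx, hk⟩ (by have := hk.1; omega)

theorem IsChainComponent.setGcd_pos (hf : Continuous f) (hC : IsChainComponent f C)
    (hx : x ∈ C) (hη : 0 < η) : 0 < setGcd (cycleLengths f C η) := by
  obtain ⟨k, hk⟩ := hC.exists_chainIn hf hx hx hη
  rw [hC.setGcd_cycleLengths hf hx hη, Nat.pos_iff_ne_zero, Ne, Nat.setGcd_eq_zero_iff]
  intro h
  have := hk.1
  have h0 : k = 0 := h ⟨x, hx, hk⟩
  omega

theorem IsChainComponent.setGcd_dvd (hf : Continuous f) (hC : IsChainComponent f C)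
    (hη : 0 < η) (h : ChainIn f C η k x x) : setGcd (cycleLengths f C η) ∣ k := by
  rw [hC.setGcd_cycleLengths hf h.left_mem hη]
  exact Nat.setGcd_dvd_of_mem ⟨x, h.left_mem, h⟩

theorem IsChainComponent.setGcd_dvd_setGcd (hf : Continuous f) (hC : IsChainComponent f C)
    (hx : x ∈ C) (hη : 0 < η) (hηδ : η ≤ δ) :
    setGcd (cycleLengths f C δ) ∣ setGcd (cycleLengths f C η) := by
  rw [hC.setGcd_cycleLengths hf hx hη, hC.setGcd_cycleLengths hf hx (hη.trans_le hηδ)]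
  exact Nat.setGcd_mono fun k ⟨y, hy, hk⟩ => ⟨y, hy, hk.mono hηδ⟩

theorem InPhase.mono (hf : Continuous f) (hC : IsChainComponent f C) (hη : 0 < η) (hηδ : η ≤ δ)
    (h : InPhase f C e η i q) : InPhase f C e δ i q := by
  have hq := h.mem
  obtain ⟨k, hki, hk⟩ := h
  exact ⟨k, hki.of_dvd (hC.setGcd_dvd_setGcd hf hq hη hηδ), hk.mono hηδ⟩

theorem IsChainComponent.inPhase_zero (hf : Continuous f) (hC : IsChainComponent f C)
    (he : e ∈ C) (hη : 0 < η) : InPhase f C e η 0 e := by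
  obtain ⟨k, hk⟩ := hC.exists_chainIn hf he he hη
  exact ⟨k, (Nat.modEq_zero_iff_dvd).2 (hC.setGcd_dvd hf hη hk), hk⟩

theorem IsChainComponent.inPhase_iterate (hf : Continuous f) (hC : IsChainComponent f C)
    (hη : 0 < η) (h : InPhase f C e η i q) (k : ℕ) : InPhase f C e η (i + k) (f^[k] q) := by
  rcases Nat.eq_zero_or_pos k with rfl | hk
  · exact h
  · exact h.append (chainIn_iterate (hC.mapsTo hf) hη.le h.mem hk)

/-- All large multiples of the period are lengths of cycles through a given point. -/
theorem IsChainComponent.exists_cycle_of_dvd (hf : Continuous f) (hC : IsChainComponent f C)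
    (hx : x ∈ C) (hη : 0 < η) :
    ∃ L₀, ∀ L ≥ L₀, setGcd (cycleLengths f C η) ∣ L → ChainIn f C η L x x := by
  set S : Set ℕ := {k | ChainIn f C η k x x}
  have hS : Nat.setGcd S ∣ setGcd (cycleLengths f C η) := by
    rw [hC.setGcd_cycleLengths hf hx hη, Nat.dvd_setGcd_iff]
    rintro k ⟨y, hy, hk⟩
    obtain ⟨a, ha⟩ := hC.exists_chainIn hf hx hy hη
    obtain ⟨b, hb⟩ := hC.exists_chainIn hf hy hx hη
    have h1 : Nat.setGcd S ∣ a + b := Nat.setGcd_dvd_of_mem (ha.trans hb)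
    have h2 : Nat.setGcd S ∣ a + k + b := Nat.setGcd_dvd_of_mem ((ha.trans hk).trans hb)
    rw [show a + k + b = a + b + k by ring] at h2
    exact (Nat.dvd_add_right h1).1 h2
  obtain ⟨n, hn⟩ := Nat.exists_mem_closure_of_ge S
  refine ⟨n + 1, fun L hL hd => ?_⟩
  have hmem := hn L (by omega) (hS.trans hd)
  have : L = 0 ∨ ChainIn f C η L x x := by
    refine AddSubmonoid.closure_induction (motive := fun L _ => L = 0 ∨ ChainIn f C η L x x)
      (fun k hk => Or.inr hk) (Or.inl rfl) ?_ hmem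
    rintro a b - - (rfl | ha) (rfl | hb)
    · exact Or.inl rfl
    · exact Or.inr (by simpa using hb)
    · exact Or.inr ha
    · exact Or.inr (ha.trans hb)
  exact this.resolve_left (by omega)

/-- Two points are joined by chains of all large lengths compatible with their phases. -/
theorem IsChainComponent.exists_chainIn_of_inPhase (hf : Continuous f)
    (hC : IsChainComponent f C) (hη : 0 < η) (hq : InPhase f C e η i q)
    (hq' : InPhase f C e η j q') :
    ∃ L₀, ∀ L ≥ L₀, i + L ≡ j [MOD setGcd (cycleLengths f C η)] → ChainIn f C η L q q' := by
  obtain ⟨a, ha, hea⟩ := hq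
  obtain ⟨b, hb, heb⟩ := hq'
  obtain ⟨r, hr⟩ := hC.exists_chainIn hf hea.right_mem hea.left_mem hη
  obtain ⟨L₀, hL₀⟩ := hC.exists_cycle_of_dvd hf hea.right_mem hη
  refine ⟨L₀ + (r + b), fun L hL hmod => ?_⟩
  obtain ⟨M, rfl⟩ := Nat.exists_eq_add_of_le (show r + b ≤ L by omega)
  have har : setGcd (cycleLengths f C η) ∣ a + r := hC.setGcd_dvd hf hη (hea.trans hr)
  have hM : setGcd (cycleLengths f C η) ∣ M := by
    have h1 : a + (r + b + M) ≡ b [MOD setGcd (cycleLengths f C η)] :=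
      (ha.add_right _).trans (hmod.trans hb.symm)
    have h2 : b + (a + r + M) ≡ b + 0 [MOD setGcd (cycleLengths f C η)] := by
      rwa [show b + (a + r + M) = a + (r + b + M) by ring]
    exact (Nat.dvd_add_right har).1 ((Nat.modEq_zero_iff_dvd).1 (Nat.ModEq.add_left_cancel' b h2))
  rw [add_comm]
  exact (hL₀ M (by omega) hM).trans (hr.trans heb)

theorem IsChainComponent.exists_iterate_eq (hf : Continuous f) (hC : IsChainComponent f C)
    (hη : 0 < η) (h : InPhase f C e η i q) : ∃ w, InPhase f C e η 0 w ∧ f^[i] w = q := by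
  obtain ⟨w, hw, rfl⟩ := (hC.surjOn hf).iterate i h.mem
  refine ⟨w, ?_, rfl⟩
  obtain ⟨k, hki, hk⟩ := h
  obtain ⟨l, hl⟩ := hC.exists_chainIn hf hk.left_mem hw hη
  obtain ⟨r, hr⟩ := hC.exists_chainIn hf hk.right_mem hk.left_mem hη
  have h1 : setGcd (cycleLengths f C η) ∣ k + r := hC.setGcd_dvd hf hη (hk.trans hr)
  have h2 : setGcd (cycleLengths f C η) ∣ l + i + r := by
    rcases Nat.eq_zero_or_pos i with rfl | hi
    · exact hC.setGcd_dvd hf hη (hl.trans hr)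
    · exact hC.setGcd_dvd hf hη ((hl.trans (chainIn_iterate (hC.mapsTo hf) hη.le hw hi)).trans hr)
  refine ⟨l, ?_, hl⟩
  have h3 : l + (i + r) ≡ 0 + (i + r) [MOD setGcd (cycleLengths f C η)] := by
    rw [← add_assoc, zero_add]
    exact ((Nat.modEq_zero_iff_dvd).2 h2).trans
      (((Nat.modEq_zero_iff_dvd).2 h1).symm.trans (hki.add_right r))
  exact Nat.ModEq.add_right_cancel' _ h3

/-- `V^s(E)` described through phases relative to a base point of `E`. -/
theorem IsChainComponent.mem_vStable_iff (hf : Continuous f) (hC : IsChainComponent f C)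
    (he : e ∈ C) : x ∈ vStable f C {y ∈ C | SimC f C e y} ↔
      ∀ η > 0, ∀ᶠ i in atTop, ∃ q, InPhase f C e η i q ∧ dist (f^[i] x) q ≤ η := by
  constructor
  · rintro ⟨-, h⟩ η hη
    have ht := h η hη {y ∈ C | SimCd f C η e y} ⟨e, he, rfl⟩ fun y hy => ⟨hy.1, hy.2 η hη⟩
    filter_upwards [ht.eventually (gt_mem_nhds hη)] with i hi
    have hne : (f^[i] '' {y ∈ C | SimCd f C η e y}).Nonempty :=
      ⟨_, e, ⟨he, simCd_iff_inPhase.2 (hC.inPhase_zero hf he hη)⟩, rfl⟩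
    obtain ⟨_, ⟨w, ⟨-, hw⟩, rfl⟩, hd⟩ := (infDist_lt_iff hne).1 hi
    refine ⟨f^[i] w, ?_, hd.le⟩
    simpa using hC.inPhase_iterate hf hη (simCd_iff_inPhase.1 hw) i
  · intro h
    constructor
    · refine Metric.tendsto_nhds.2 fun ε hε => ?_
      filter_upwards [h (ε / 2) (by positivity)] with i ⟨q, hq, hd⟩
      rw [Real.dist_0_eq_abs, abs_of_nonneg infDist_nonneg]
      linarith [infDist_le_dist_of_mem hq.mem (x := f^[i] x)]
    · rintro δ hδ _ ⟨x₀, hx₀, rfl⟩ hsub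
      refine Metric.tendsto_nhds.2 fun ε hε => ?_
      have hx₀e : InPhase f C x₀ δ 0 e := simCd_iff_inPhase.1
        (hsub ⟨he, fun γ hγ => simCd_iff_inPhase.2 (hC.inPhase_zero hf he hγ)⟩).2
      have hmin : 0 < min (ε / 2) δ := by positivity
      filter_upwards [h _ hmin] with i ⟨q, hq, hd⟩
      obtain ⟨w, hw, hwq⟩ := hC.exists_iterate_eq hf hδ (hx₀e.trans
        (hq.mono hf hC hmin (min_le_right _ _)))
      rw [Real.dist_0_eq_abs, abs_of_nonneg infDist_nonneg]
      have := infDist_le_dist_of_mem (x := f^[i] x) (mem_image_of_mem f^[i]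
        (show w ∈ {y ∈ C | SimCd f C δ x₀ y} from ⟨hw.mem, simCd_iff_inPhase.2 hw⟩))
      rw [hwq] at this
      linarith [min_le_left (ε / 2) δ]

end Phases

section Construction

/-- Shadowing a given sequence for a long time suffices to be in an open set containing all points
shadowing it forever. -/
theorem exists_finite_shadow_mem {Z : Type*} [MetricSpace Z] [CompactSpace Z] {g : Z → Z}
    (hg : Continuous g) {V : Set Z} (hV : IsOpen V) {p : ℕ → Z} {ε : ℝ}
    (h : ∀ z, (∀ i, dist (g^[i] z) (p i) ≤ ε) → z ∈ V) :
    ∃ K, ∀ z, (∀ i < K, dist (g^[i] z) (p i) ≤ ε) → z ∈ V := by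
  set W : ℕ → Set Z := fun K => {z | ∀ i < K, dist (g^[i] z) (p i) ≤ ε}
  have hW : ∀ K, IsClosed (W K) := fun K => by
    simp only [W, ofPred_forall]
    exact isClosed_iInter fun i => isClosed_iInter fun _ =>
      isClosed_le ((hg.iterate i).dist continuous_const) continuous_const
  have hanti : Antitone W := fun a b hab z hz i hi => hz i (hi.trans_le hab)
  obtain ⟨K, hK⟩ := exists_subset_nhds_of_isCompact' (directed_of_isDirected_le hanti)
    (fun K => (hW K).isCompact) hW (U := V) fun z hz => hV.mem_nhds
      (h z fun i => mem_iInter.1 hz (i + 1) i (Nat.lt_succ_self i))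
  exact ⟨K, fun z hz => hK hz⟩

/-- Iterating a one-step modification of eventual orbits yields a pseudo-orbit whose jumps tend
to zero, all of whose shadowing points lie in a prescribed sequence of sets. -/
theorem exists_pseudoOrbit {Z : Type*} [MetricSpace Z] {g : Z → Z} {good : ℕ → ℕ → Z → Prop}
    (hgood : ∀ k i z, good (k + 1) i z → good k i z) {η : ℕ → ℝ} (hη : Antitone η)
    (hη0 : ∀ k, 0 ≤ η k) {U : ℕ → Set Z} {ε : ℝ}
    (hstep : ∀ (k : ℕ) (p : ℕ → Z) (K : ℕ), (∀ i ≥ K, p (i + 1) = g (p i) ∧ good k i (p i)) →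
      ∃ (p' : ℕ → Z) (K' : ℕ), K < K' ∧ (∀ i ≤ K, p' i = p i) ∧
        (∀ i ≥ K, dist (g (p' i)) (p' (i + 1)) ≤ η k ∧ good k i (p' i)) ∧
        (∀ i ≥ K', p' (i + 1) = g (p' i) ∧ good (k + 1) i (p' i)) ∧
        ∀ z, (∀ i < K', dist (g^[i] z) (p' i) ≤ ε) → z ∈ U k)
    (x : Z) (hx : ∀ᶠ i in atTop, good 0 i (g^[i] x)) :
    ∃ P : ℕ → Z, P 0 = x ∧ (∀ i, dist (g (P i)) (P (i + 1)) ≤ η 0) ∧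
      (∀ k, ∀ᶠ i in atTop, dist (g (P i)) (P (i + 1)) ≤ η k ∧ good k i (P i)) ∧
      ∀ z, (∀ i, dist (g^[i] z) (P i) ≤ ε) → ∀ k, z ∈ U k := by
  obtain ⟨K₀, hK₀⟩ := eventually_atTop.1 hx
  choose! np nK hlt hagree herr hinv hU using hstep
  let S : ℕ → (ℕ → Z) × ℕ := fun k =>
    Nat.rec (fun i => g^[i] x, K₀) (fun k s => (np k s.1 s.2, nK k s.1 s.2)) k
  have hI : ∀ k, ∀ i ≥ (S k).2, (S k).1 (i + 1) = g ((S k).1 i) ∧ good k i ((S k).1 i) := by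
    intro k
    induction k with
    | zero => exact fun i hi => ⟨Function.iterate_succ_apply' g i x, hK₀ i hi⟩
    | succ k ih => exact hinv k _ _ ih
  have hmono : StrictMono fun k => (S k).2 := strictMono_nat_of_lt_succ fun k => hlt k _ _ (hI k)
  have hle : ∀ k, k ≤ (S k).2 := hmono.id_le
  have hstab : ∀ k l, k ≤ l → ∀ i ≤ (S k).2, (S l).1 i = (S k).1 i := by
    intro k l hkl
    induction l, hkl using Nat.le_induction with
    | base => exact fun _ _ => rfl
    | succ l hl ih => exact fun i hi =>
        (hagree l _ _ (hI l) i (hi.trans (hmono.monotone hl))).trans (ih i hi)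
  have hgood' : ∀ k l, k ≤ l → ∀ i z, good l i z → good k i z := by
    intro k l hkl
    induction l, hkl using Nat.le_induction with
    | base => exact fun _ _ h => h
    | succ l hl ih => exact fun i z h => ih i z (hgood l i z h)
  have hlate : ∀ k l, k ≤ l → ∀ i ≥ (S k).2,
      dist (g ((S l).1 i)) ((S l).1 (i + 1)) ≤ η k ∧ good k i ((S l).1 i) := by
    intro k l hkl
    induction l, hkl using Nat.le_induction with
    | base =>
      intro i hi
      obtain ⟨h1, h2⟩ := hI k i hi
      exact ⟨by rw [h1, dist_self]; exact hη0 k, h2⟩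
    | succ l hl ih =>
      intro i hi
      rcases lt_or_ge i (S l).2 with h | h
      · rw [hstab l (l + 1) (Nat.le_succ l) i h.le, hstab l (l + 1) (Nat.le_succ l) (i + 1) h]
        exact ih i hi
      · obtain ⟨h1, h2⟩ := herr l _ _ (hI l) i h
        exact ⟨h1.trans (hη hl), hgood' k l hl _ _ h2⟩
  have hP : ∀ l i, i ≤ (S l).2 → (S i).1 i = (S l).1 i := by
    intro l i hi
    rcases le_total i l with h | h
    · exact (hstab i l h i (hle i)).symm
    · exact hstab l i h i hi
  have hPlate : ∀ k, ∀ i ≥ (S k).2,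
      dist (g ((S i).1 i)) ((S (i + 1)).1 (i + 1)) ≤ η k ∧ good k i ((S i).1 i) := by
    intro k i hi
    have h1 := hle (max k (i + 1))
    rw [hP (max k (i + 1)) i (by omega), hP (max k (i + 1)) (i + 1) (by omega)]
    exact hlate k _ (le_max_left _ _) i hi
  refine ⟨fun i => (S i).1 i, rfl, fun i => ?_, fun k => eventually_atTop.2 ⟨_, hPlate k⟩,
    fun z hz k => ?_⟩
  · rcases lt_or_ge i K₀ with h | h
    · have h1 : (S i).1 i = (S 0).1 i := hP 0 i h.le
      have h2 : (S (i + 1)).1 (i + 1) = (S 0).1 (i + 1) := hP 0 (i + 1) h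
      have h3 : (S 0).1 (i + 1) = g ((S 0).1 i) := Function.iterate_succ_apply' g i x
      dsimp only
      rw [h1, h2, h3, dist_self]
      exact hη0 0
    · exact (hPlate 0 i h).1
  · refine hU k _ _ (hI k) z fun i hi => ?_
    have h : dist (g^[i] z) ((S i).1 i) ≤ ε := hz i
    rwa [hP (k + 1) i hi.le] at h

theorem iterate_coordinatewise {X : Type*} {n : ℕ} (f : X → X) (i : ℕ) (x : Fin n → X) :
    (fun (x : Fin n → X) j => f (x j))^[i] x = fun j => f^[i] (x j) := by
  induction i with
  | zero => rfl
  | succ i ih => simp only [Function.iterate_succ_apply', ih]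

variable {X : Type*} [MetricSpace X] [CompactSpace X] {f : X → X} {C : Set X} {d e : X}

theorem exists_pseudoOrbit_step (hf : Continuous f) (hC : IsChainComponent f C) (hd : d ∈ C)
    (he : e ∈ C) {n : ℕ} {a : Fin n → X} (ha : ∀ j, a j ∈ vStable f C {y ∈ C | SimC f C d y})
    {η η' : ℝ} (hη' : 0 < η') (hηη' : η' ≤ η) (p : ℕ → Fin n → X) (K : ℕ)
    (hp : ∀ i ≥ K, (p (i + 1) = fun j => f (p i j)) ∧
      ∀ j, ∃ q, InPhase f C e η i q ∧ dist (p i j) q ≤ η) :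
    ∃ (p' : ℕ → Fin n → X) (M T : ℕ), K < M ∧ (∀ i ≤ K, p' i = p i) ∧
      (∀ i ≥ K, dist (fun j => f (p' i j)) (p' (i + 1)) ≤ 2 * η ∧
        ∀ j, ∃ q, InPhase f C e η i q ∧ dist (p' i j) q ≤ η) ∧
      (∀ i ≥ M, ∀ j, ∃ q, InPhase f C e η' i q ∧ dist (p' i j) q ≤ η') ∧
      ∀ i, p' (M + i) = fun j => f^[T + i] (a j) := by
  have hη : 0 < η := hη'.trans_le hηη'
  have haD : ∀ᶠ i in atTop, ∀ j, ∃ q, InPhase f C d η' i q ∧ dist (f^[i] (a j)) q ≤ η' :=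
    eventually_all.2 fun j => (hC.mem_vStable_iff hf hd).1 (ha j) η' hη'
  obtain ⟨T, hT⟩ := eventually_atTop.1 haD
  obtain ⟨t, ht⟩ := hC.exists_chainIn hf he hd hη'
  choose q hq hpq using (hp (K + 1) (Nat.le_succ K)).2
  choose q' hq' haq' using hT T le_rfl
  have hL : ∀ᶠ L in atTop, ∀ j, K + 1 + L ≡ t + T [MOD setGcd (cycleLengths f C η)] →
      ChainIn f C η L (q j) (q' j) := eventually_all.2 fun j => eventually_atTop.2
    (hC.exists_chainIn_of_inPhase hf hη (hq j)
      (((hq' j).change_base ht).mono hf hC hη' hηη'))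
  obtain ⟨L₀, hL₀⟩ := eventually_atTop.1 hL
  have hm := hC.setGcd_pos hf he hη'
  set m := setGcd (cycleLengths f C η') with hm_def
  have hmul : K + 1 + L₀ + 1 ≤ m * (K + 1 + L₀ + 1) := Nat.le_mul_of_pos_left _ hm
  obtain ⟨L, hL⟩ : ∃ L, K + 1 + L = t + T + m * (K + 1 + L₀ + 1) :=
    ⟨t + T + m * (K + 1 + L₀ + 1) - (K + 1), by omega⟩
  have hLmod : K + 1 + L ≡ t + T [MOD m] := by
    rw [hL]
    simp [Nat.ModEq]
  choose hL1 c hc0 hcL hcC hcd using fun j => hL₀ L (by omega) j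
    (hLmod.of_dvd (hC.setGcd_dvd_setGcd hf he hη' hηη'))
  have hLpos : 1 ≤ L := by omega
  set p' : ℕ → Fin n → X := fun i => if i ≤ K then p i else
    if i < K + 1 + L then fun j => c j (i - (K + 1)) else
      fun j => f^[T + (i - (K + 1 + L))] (a j) with hp'_def
  have h1 : ∀ i ≤ K, p' i = p i := fun i hi => if_pos hi
  have h2 : ∀ i < L, p' (K + 1 + i) = fun j => c j i := fun i hi => by
    simp only [hp'_def]
    rw [if_neg (by omega), if_pos (by omega), Nat.add_sub_cancel_left]
  have h3 : ∀ i, p' (K + 1 + L + i) = fun j => f^[T + i] (a j) := fun i => by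
    simp only [hp'_def]
    rw [if_neg (by omega), if_neg (by omega), Nat.add_sub_cancel_left]
  have hlate : ∀ i ≥ K + 1 + L, ∀ j, ∃ q, InPhase f C e η' i q ∧ dist (p' i j) q ≤ η' := by
    intro i hi j
    obtain ⟨i, rfl⟩ := Nat.exists_eq_add_of_le hi
    obtain ⟨r, hr, hdr⟩ := hT (T + i) (Nat.le_add_right _ _) j
    refine ⟨r, (hr.change_base ht).congr ?_, by rwa [h3]⟩
    rw [← add_assoc]
    exact (hLmod.symm).add_right i
  refine ⟨p', K + 1 + L, T, by omega, h1, fun i hi => ⟨?_, fun j => ?_⟩, hlate, h3⟩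
  · rw [dist_pi_le_iff (by positivity)]
    intro j
    rcases hi.eq_or_lt with rfl | hi
    · have h4 := h2 0 hLpos
      rw [add_zero] at h4
      rw [h1 _ le_rfl, h4, ← congrFun (hp K le_rfl).1 j]
      dsimp only
      rw [hc0]
      linarith [hpq j]
    obtain ⟨i, rfl⟩ := Nat.exists_eq_add_of_le (Nat.succ_le_of_lt hi)
    rcases lt_trichotomy (i + 1) L with h | h | h
    · rw [Nat.succ_eq_add_one, h2 i (by omega), add_assoc (K + 1), h2 (i + 1) h]
      linarith [hcd j i (by omega)]
    · have h4 := h3 0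
      rw [add_zero, add_zero, ← h] at h4
      rw [Nat.succ_eq_add_one, h2 i (by omega), add_assoc (K + 1), h4]
      have h5 := hcd j i (by omega)
      rw [h, hcL j] at h5
      have h6 := dist_triangle_right (f (c j i)) (f^[T] (a j)) (q' j)
      linarith [haq' j]
    · obtain ⟨i, rfl⟩ := Nat.exists_eq_add_of_le (Nat.le_of_lt_succ h)
      rw [Nat.succ_eq_add_one, ← add_assoc (K + 1) L i, h3, add_assoc (K + 1 + L) i 1, h3,
        ← add_assoc]
      dsimp only
      rw [Function.iterate_succ_apply', dist_self]
      positivity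
  · rcases lt_or_ge i (K + 1 + L) with h | h
    · rcases hi.eq_or_lt with rfl | hi
      · rw [h1 _ le_rfl]
        exact (hp K le_rfl).2 j
      obtain ⟨i, rfl⟩ := Nat.exists_eq_add_of_le (Nat.succ_le_of_lt hi)
      rw [Nat.succ_eq_add_one] at h ⊢
      refine ⟨c j i, ?_, by rw [h2 i (by omega), dist_self]; exact hη.le⟩
      rcases Nat.eq_zero_or_pos i with rfl | hi0
      · rw [hc0]
        exact hq j
      · exact (hq j).append ((ChainIn.split_at (hc0 j) (hcL j) (hcC j) (hcd j) (by omega)).1 hi0)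
    · obtain ⟨r, hr, hdr⟩ := hlate i h j
      exact ⟨r, hr.mono hf hC hη' hηη', hdr.trans hηη'⟩

/-- If all points shadowing an eventual orbit of the tuple `a` lie in `⋂ k, U k`, then `⋂ k, U k`
contains tuples of points of `V^s(E)` close to any given such tuple. -/
theorem exists_vStable_near (hf : Continuous f) (hsls : SLimitShadowing f)
    (hC : IsChainComponent f C) (hd : d ∈ C) (he : e ∈ C) {n : ℕ} {a x : Fin n → X}
    (ha : ∀ j, a j ∈ vStable f C {y ∈ C | SimC f C d y})
    (hx : ∀ j, x j ∈ vStable f C {y ∈ C | SimC f C e y}) {ε : ℝ} (hε : 0 < ε)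
    {U : ℕ → Set (Fin n → X)} (hUo : ∀ k, IsOpen (U k))
    (hU : ∀ (M T : ℕ) (z : Fin n → X),
      (∀ i j, dist (f^[M + i] (z j)) (f^[T + i] (a j)) ≤ ε) → ∀ k, z ∈ U k) :
    ∃ y : Fin n → X, (∀ j, y j ∈ vStable f C {y ∈ C | SimC f C e y}) ∧ dist y x ≤ ε ∧
      ∀ k, y ∈ U k := by
  obtain ⟨δ, hδ, hsh⟩ := hsls ε hε
  set g : (Fin n → X) → Fin n → X := fun x j => f (x j) with hg_def
  have hgc : Continuous g := by fun_prop
  set η : ℕ → ℝ := fun k => δ / 2 / (k + 1)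
  have hηpos : ∀ k, 0 < η k := fun k => by positivity
  have hηanti : Antitone η := fun k l hkl => by
    have : (k : ℝ) ≤ l := by exact_mod_cast hkl
    dsimp only [η]
    gcongr
  have hηlim : Tendsto η atTop (𝓝 0) :=
    tendsto_const_nhds.div_atTop (tendsto_natCast_atTop_atTop.atTop_add tendsto_const_nhds)
  set good : ℕ → ℕ → (Fin n → X) → Prop := fun k i z =>
    ∀ j, ∃ q, InPhase f C e (η k) i q ∧ dist (z j) q ≤ η k
  have hle : ∀ k, η (k + 1) ≤ η k := fun k => hηanti (Nat.le_succ k)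
  obtain ⟨P, hP0, hPerr, hPlate, hPU⟩ : ∃ P : ℕ → Fin n → X, P 0 = x ∧
      (∀ i, dist (g (P i)) (P (i + 1)) ≤ 2 * η 0) ∧
      (∀ k, ∀ᶠ i in atTop, dist (g (P i)) (P (i + 1)) ≤ 2 * η k ∧ good k i (P i)) ∧
      ∀ z, (∀ i, dist (g^[i] z) (P i) ≤ ε) → ∀ k, z ∈ U k := by
    refine exists_pseudoOrbit (η := fun k => 2 * η k) ?_ (hηanti.const_mul zero_le_two)
      (fun k => by have := hηpos k; positivity) ?_ x ?_
    · intro k i z hz j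
      obtain ⟨q, hq, hzq⟩ := hz j
      exact ⟨q, hq.mono hf hC (hηpos _) (hle k), hzq.trans (hle k)⟩
    · intro k p K hp
      obtain ⟨p', M, T, hKM, hagree, herr, hlate, horb⟩ :=
        exists_pseudoOrbit_step hf hC hd he ha (hηpos (k + 1)) (hle k) p K hp
      obtain ⟨K', hK'⟩ := exists_finite_shadow_mem hgc (hUo k) (p := p') (ε := ε)
        fun z hz => hU M T z (fun i j => by
          have := hz (M + i)
          rw [horb, iterate_coordinatewise] at this
          exact (dist_le_pi_dist _ _ j).trans this) k
      refine ⟨p', max M K', hKM.trans_le (le_max_left _ _), hagree, herr, fun i hi => ⟨?_, ?_⟩,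
        fun z hz => hK' z fun i hi => hz i (hi.trans_le (le_max_right _ _))⟩
      · obtain ⟨i, rfl⟩ := Nat.exists_eq_add_of_le ((le_max_left _ _).trans hi)
        rw [add_assoc, horb, horb]
        funext j
        rw [← add_assoc, Function.iterate_succ_apply']
      · exact hlate i ((le_max_left _ _).trans hi)
    · refine eventually_all.2 fun j => ?_
      filter_upwards [(hC.mem_vStable_iff hf he).1 (hx j) (η 0) (hηpos 0)] with i hi
      rwa [iterate_coordinatewise]
  have hη0 : 2 * η 0 = δ := by
    simp only [η]
    push_cast
    ring
  have hlim : ∀ j, Tendsto (fun i => dist (f (P i j)) (P (i + 1) j)) atTop (𝓝 0) := by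
    intro j
    refine Metric.tendsto_nhds.2 fun γ hγ => ?_
    obtain ⟨k, hk⟩ := (hηlim.eventually (gt_mem_nhds (half_pos hγ))).exists
    filter_upwards [hPlate k] with i hi
    rw [Real.dist_0_eq_abs, abs_of_nonneg dist_nonneg]
    have := dist_le_pi_dist (g (P i)) (P (i + 1)) j
    linarith [hi.1]
  choose y hy hylim using fun j => hsh (fun i => P i j)
    (fun i => (dist_le_pi_dist (g (P i)) (P (i + 1)) j).trans ((hPerr i).trans hη0.le)) (hlim j)
  have hyP : ∀ i, dist (g^[i] y) (P i) ≤ ε := fun i => by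
    rw [iterate_coordinatewise, dist_pi_le_iff hε.le]
    exact fun j => hy j i
  refine ⟨y, fun j => (hC.mem_vStable_iff hf he).2 fun γ hγ => ?_, hP0 ▸ hyP 0, hPU y hyP⟩
  obtain ⟨k, hk⟩ := (hηlim.eventually (gt_mem_nhds (half_pos hγ))).exists
  filter_upwards [hPlate k, (hylim j).eventually (gt_mem_nhds (half_pos hγ))] with i hi hyi
  obtain ⟨q, hq, hPq⟩ := hi.2 j
  exact ⟨q, hq.mono hf hC (hηpos k) (by linarith),
    (dist_triangle _ (P i j) _).trans (by linarith)⟩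

end Construction

section Residual

/-- A set containing a countable intersection of relatively dense `G_δ` sets is residual. -/
theorem ResidualIn.of_isGδ {α : Type*} [TopologicalSpace α] {T S : Set α} {R : ℕ → Set α}
    (hR : ∀ m, IsGδ (R m)) (hT : ∀ m, T ⊆ closure (R m ∩ T)) (hS : (⋂ m, R m) ∩ T ⊆ S) :
    ResidualIn T S := by
  choose V hVo hV using fun m => (hR m).eq_iInter_nat
  refine ⟨fun i => V i.unpair.1 i.unpair.2, fun i => hVo _ _, fun i => (hT i.unpair.1).trans
    (closure_mono (inter_subset_inter_left _ ?_)), fun x hx => hS ⟨mem_iInter.2 fun m => ?_, hx.2⟩⟩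
  · rw [hV]
    exact iInter_subset _ _
  · rw [hV]
    refine mem_iInter.2 fun k => ?_
    have := mem_iInter.1 hx.1 (Nat.pair m k)
    simpa using this

variable {X : Type*} [MetricSpace X] {f : X → X} {C : Set X} {d e : X} {n : ℕ} {a z : Fin n → X}
  {F : Set (Set ℕ)} {r δ ε : ℝ} {M T : ℕ}

theorem isGδ_setOf_sSet (hF : CompatibleFamily F (fun x : Fin n → X => fun j => f (x j))) :
    IsGδ {z : Fin n → X | Sset f z r ∈ F} := by
  have hU : IsOpen {w : Fin n → X | ∀ j k : Fin n, j < k → r < dist (w j) (w k)} := by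
    simp only [ofPred_forall]
    exact isOpen_iInter_of_finite fun j => isOpen_iInter_of_finite fun k =>
      isOpen_iInter_of_finite fun _ => isOpen_lt continuous_const (by fun_prop)
  simpa only [iterate_coordinatewise, mem_ofPred_eq, Sset] using hF _ hU

theorem isGδ_setOf_tSet (hF : CompatibleFamily F (fun x : Fin n → X => fun j => f (x j))) :
    IsGδ {z : Fin n → X | Tset f z r ∈ F} := by
  have hU : IsOpen {w : Fin n → X | ∀ j k : Fin n, j < k → dist (w j) (w k) < r} := by
    simp only [ofPred_forall]
    exact isOpen_iInter_of_finite fun j => isOpen_iInter_of_finite fun k =>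
      isOpen_iInter_of_finite fun _ => isOpen_lt (by fun_prop) continuous_const
  simpa only [iterate_coordinatewise, mem_ofPred_eq, Tset] using hF _ hU

theorem sSet_mem_of_shadow (hF : FurstenbergFamily F) (hFtr : TranslationInvariantFamily F)
    (ha : Sset f a δ ∈ F) (hε : r + 2 * ε ≤ δ)
    (h : ∀ i j, dist (f^[M + i] (z j)) (f^[T + i] (a j)) ≤ ε) : Sset f z r ∈ F := by
  refine hF.1 _ _ (hFtr _ (hFtr _ ha T).2 M).1 ?_
  rintro _ ⟨i, hi, rfl⟩ j k hjk
  have h1 : δ < dist (f^[i + T] (a j)) (f^[i + T] (a k)) := hi j k hjk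
  have hj := h i j
  have hk := h i k
  rw [add_comm M, add_comm T] at hj hk
  have h2 := dist_triangle4_left (f^[i + M] (z j)) (f^[i + M] (z k)) (f^[i + T] (a j))
    (f^[i + T] (a k))
  dsimp only
  linarith

theorem tSet_mem_of_shadow (hF : FurstenbergFamily F) (hFfull : FullFamily F) (hε : 2 * ε < r)
    (h : ∀ i j, dist (f^[M + i] (z j)) (f^[T + i] e) ≤ ε) : Tset f z r ∈ F := by
  obtain ⟨A, hA⟩ := hF.2.1
  refine hF.1 _ _ (hFfull A hA M) ?_
  rintro i ⟨-, hi⟩ j k -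
  obtain ⟨i, rfl⟩ := Nat.exists_eq_add_of_le hi
  linarith [dist_triangle_right (f^[M + i] (z j)) (f^[M + i] (z k)) (f^[T + i] e), h i j, h i k]

variable [CompactSpace X]

/-- A `G_δ` set containing all tuples whose orbits eventually shadow an eventual orbit of a tuple
in `V^s(D)` is dense in the power of `V^s(E)`. -/
theorem subset_closure_of_shadow (hf : Continuous f) (hsls : SLimitShadowing f)
    (hC : IsChainComponent f C) (hd : d ∈ C) (he : e ∈ C)
    (ha : ∀ j, a j ∈ vStable f C {y ∈ C | SimC f C d y}) {R : Set (Fin n → X)} (hR : IsGδ R)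
    (hε : 0 < ε) (h : ∀ (M T : ℕ) (z : Fin n → X),
      (∀ i j, dist (f^[M + i] (z j)) (f^[T + i] (a j)) ≤ ε) → z ∈ R) :
    {x : Fin n → X | ∀ j, x j ∈ vStable f C {y ∈ C | SimC f C e y}} ⊆
      closure (R ∩ {x | ∀ j, x j ∈ vStable f C {y ∈ C | SimC f C e y}}) := by
  obtain ⟨U, hUo, rfl⟩ := hR.eq_iInter_nat
  intro x hx
  refine Metric.mem_closure_iff.2 fun γ hγ => ?_
  obtain ⟨y, hy, hyx, hyU⟩ := exists_vStable_near hf hsls hC hd he ha hx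
    (lt_min hε (half_pos hγ)) hUo fun M T z hz =>
      mem_iInter.1 (h M T z fun i j => (hz i j).trans (min_le_left _ _))
  refine ⟨y, ⟨mem_iInter.2 hyU, hy⟩, ?_⟩
  rw [dist_comm]
  linarith [hyx.trans (min_le_right _ _)]

theorem IsChainComponent.mem_vStable_self (hf : Continuous f) (hC : IsChainComponent f C)
    (he : e ∈ C) : e ∈ vStable f C {y ∈ C | SimC f C e y} :=
  (hC.mem_vStable_iff hf he).2 fun η hη => Eventually.of_forall fun i => ⟨f^[i] e, by
    simpa using hC.inPhase_iterate hf hη (hC.inPhase_zero hf he hη) i, by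
    rw [dist_self]; exact hη.le⟩

end Residual

/-- Theorem 1.4: under s-limit shadowing, compatibility of `ℱ, 𝒢` and
translation invariance of `ℱ`, an n-tuple in `[V^s(D)]ⁿ` with `S_f(a₁,…,aₙ;δ) ∈ ℱ`
yields generic `(ℱ,𝒢)`-n-r-chaos of `V^s(E)` for all `E ∈ 𝒟(C)` and `0 < r < δ`. -/
theorem generic_chaos_of_sSet_tuple
    {X : Type*} [MetricSpace X] [CompactSpace X]
    (f : X → X) (hf : Continuous f) (hsls : SLimitShadowing f)
    (C : Set X) (hC : IsChainComponent f C) (D : Set X) (hD : D ∈ DClasses f C)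
    (F G : Set (Set ℕ)) (hF : FurstenbergFamily F) (hFfull : FullFamily F)
    (hG : FurstenbergFamily G) (hGfull : FullFamily G)
    (hFcomp : ∀ m : ℕ, 2 ≤ m → CompatibleFamily F (fun x : Fin m → X => fun j => f (x j)))
    (hGcomp : ∀ m : ℕ, 2 ≤ m → CompatibleFamily G (fun x : Fin m → X => fun j => f (x j)))
    (hFtr : TranslationInvariantFamily F)
    (n : ℕ) (hn : 2 ≤ n) (δ : ℝ) (hδ : 0 < δ)
    (a : Fin n → X) (ha : ∀ j, a j ∈ vStable f C D) (hS : Sset f a δ ∈ F) :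
    ∀ E ∈ DClasses f C, ∀ r : ℝ, 0 < r → r < δ →
      GenericChaotic f F G n r (vStable f C E) := by
  obtain ⟨d, hd, rfl⟩ := hD
  rintro _ ⟨e, he, rfl⟩ r - hrδ
  refine ResidualIn.of_isGδ (R := fun m => Nat.casesOn m {z | Sset f z r ∈ F}
    fun m => {z | Tset f z (1 / (m + 1)) ∈ G}) ?_ ?_ ?_
  · rintro (_ | m)
    · exact isGδ_setOf_sSet (hFcomp n hn)
    · exact isGδ_setOf_tSet (hGcomp n hn)
  · rintro (_ | m)
    · exact subset_closure_of_shadow hf hsls hC hd he ha (isGδ_setOf_sSet (hFcomp n hn))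
        (half_pos (sub_pos.2 hrδ)) fun M T z hz =>
          sSet_mem_of_shadow hF hFtr hS (by linarith) hz
    · have hm : (0 : ℝ) < 1 / (m + 1) := Nat.one_div_pos_of_nat
      exact subset_closure_of_shadow hf hsls hC he he (a := fun _ => e)
        (fun _ => hC.mem_vStable_self hf he) (isGδ_setOf_tSet (hGcomp n hn))
        (ε := 1 / (m + 1) / 4) (by positivity) fun M T z hz =>
          tSet_mem_of_shadow hG hGfull (by linarith) hz
  · rintro z ⟨hz, hzV⟩
    rw [mem_iInter] at hz
    refine ⟨hzV, hz 0, fun ε hε => ?_⟩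
    obtain ⟨m, hm⟩ := exists_nat_one_div_lt hε
    exact hG.1 _ _ (hz (m + 1)) fun i hi j k hjk => (hi j k hjk).trans hm
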